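/- arXiv:2505.22055 — 2 statements merged into one kernel-verified Lean document; each statement's English description precedes it below -/
import Mathlib

section
/- Let q = 2^e, k ≥ 1, and w ∈ F_{q^{2k+1}}. The only solution z ∈ F_{q^{2k+1}} of the equation z^{q+1} = w z^q + w^q z is z = 0. -/
/-- For `q = 2^e` and any `w ∈ F_{q^{2k+1}}`, the equation `z^{q+1} = wz^q + w^q z`
has only the solution `z = 0`. -/
theorem only_zero_solution (e k : ℕ) (he : 1 ≤ e) (hk : 1 ≤ k)
    (F : Type) [Field F] [Fintype F] (hF : Fintype.card F = (2 ^ e) ^ (2 * k + 1))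
    (w z : F) (h : z ^ (2 ^ e + 1) = w * z ^ (2 ^ e) + w ^ (2 ^ e) * z) :
    z = 0 := by
  have h2 : (2 : F) = 0 := by
    have h0 := FiniteField.cast_card_eq_zero F
    rw [hF] at h0
    push_cast at h0
    exact pow_eq_zero_iff (by omega) |>.mp (pow_eq_zero_iff (by omega) |>.mp h0)
  haveI : CharP F 2 := CharTwo.of_one_ne_zero_of_two_eq_zero one_ne_zero h2
  by_contra hz
  obtain ⟨u, rfl⟩ : ∃ u, w = u * z := ⟨w / z, by field_simp⟩
  have hu : u ^ (2 ^ e) = u + 1 := by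
    have hzq : z ^ (2 ^ e + 1) ≠ 0 := pow_ne_zero _ hz
    have h1 : z ^ (2 ^ e + 1) * (u ^ (2 ^ e) - (u + 1)) = 0 := by
      rw [mul_pow] at h
      have e1 : z ^ (2 ^ e + 1) = z ^ (2 ^ e) * z := pow_succ _ _
      rw [e1] at h ⊢
      linear_combination (-1 : F) * h - u * (z ^ (2 ^ e) * z) * h2
    exact sub_eq_zero.mp ((mul_eq_zero.mp h1).resolve_left hzq)
  have hev : ∀ j : ℕ, u ^ ((2 ^ e) ^ (2 * j)) = u := by
    intro j
    induction j with
    | zero => simp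
    | succ j ih =>
      have : (2 ^ e) ^ (2 * (j + 1)) = (2 ^ e) ^ (2 * j) * 2 ^ e * 2 ^ e := by ring
      rw [this, pow_mul, pow_mul, ih, hu, add_pow_char_pow, hu, one_pow]
      linear_combination h2
  have hc := FiniteField.pow_card u
  rw [hF, pow_succ, pow_mul, hev, hu] at hc
  exact one_ne_zero (add_eq_left.mp hc)
end

section
/- Let q = 2^e, k ≥ 1, and x̄ = (x, x_1), ȳ = (y, y_1) ∈ F_{q^{2k+1}} × F_q linearly independent over F_q. If α ∈ F_q satisfies α^2 (x_1 y + y_1 x)^{q+1} + α (x y^q + x^q y) = 0, then α = 0. -/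
/-- The Artin–Schreier type equation `u ^ q = u + 1` has no solution in odd degree. -/
theorem no_AS (e k : ℕ) (F : Type) [Field F] [Fintype F] [CharP F 2]
    (hF : Fintype.card F = (2 ^ e) ^ (2 * k + 1)) (u : F) (hu : u ^ (2 ^ e) = u + 1) : False := by
  have key : ∀ n : ℕ, u ^ ((2 ^ e) ^ n) = u + (n : F) := by
    intro n
    induction n with
    | zero => simp
    | succ n ih =>
      have hn : ((n : F)) ^ (2 ^ e) = n := by
        rcases Nat.even_or_odd n with hn | hn
        · have : (n : F) = 0 := (CharP.cast_eq_zero_iff F 2 n).2 hn.two_dvd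
          simp [this]
        · obtain ⟨m, rfl⟩ := hn
          have h2 : (2 : F) = 0 := CharTwo.two_eq_zero
          simp [h2]
      rw [pow_succ, pow_mul, ih, add_pow_char_pow, hu, hn]
      push_cast; ring
  have h1 := key (2 * k + 1)
  rw [← hF, FiniteField.pow_card] at h1
  have h2 : (2 : F) = 0 := CharTwo.two_eq_zero
  simp [h2] at h1

theorem z_eq_zero (e k : ℕ) (F : Type) [Field F] [Fintype F] [CharP F 2]
    (hF : Fintype.card F = (2 ^ e) ^ (2 * k + 1)) (x y a b c : F)
    (ha : a ^ (2 ^ e) = a) (hb : b ^ (2 ^ e) = b) (hc : c ^ (2 ^ e) = c) (hc0 : c ≠ 0)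
    (ha0 : a ≠ 0)
    (h : c * (a * y + b * x) ^ (2 ^ e + 1) + (x * y ^ (2 ^ e) + x ^ (2 ^ e) * y) = 0) :
    a * y + b * x = 0 := by
  by_contra hz
  have h2 : (2 : F) = 0 := CharTwo.two_eq_zero
  have hzq : (a * y + b * x) ^ (2 ^ e) = a * y ^ (2 ^ e) + b * x ^ (2 ^ e) := by
    rw [add_pow_char_pow, mul_pow, mul_pow, ha, hb]
  apply no_AS e k F hF (x / (c * a * (a * y + b * x)))
  rw [div_pow, mul_pow, mul_pow, ha, hc]
  have hzq0 : (a * y + b * x) ^ (2 ^ e) ≠ 0 := pow_ne_zero _ hz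
  rw [pow_succ] at h
  generalize hzz : a * y + b * x = z at *
  generalize z ^ (2 ^ e) = Z at *
  generalize x ^ (2 ^ e) = X at *
  generalize y ^ (2 ^ e) = Y at *
  field_simp
  linear_combination (-a) * h + x * hzq - X * hzz + (a * x * Y + b * x * X + X * a * y - x * Z) * h2

/-- For linearly independent `x̄ = (x,x₁)`, `ȳ = (y,y₁)` in `F_{q^{2k+1}} × F_q`
(`q = 2^e`), if `α²(x₁y+y₁x)^{q+1} + α(xy^q + x^q y) = 0` with `α ∈ F_q`, then `α = 0`. -/
theorem E_zero_only_from_zero (e k : ℕ) (he : 1 ≤ e) (hk : 1 ≤ k)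
    (K F : Type) [Field K] [Field F] [Algebra K F] [Fintype K] [Fintype F]
    (hK : Fintype.card K = 2 ^ e) (hF : Fintype.card F = (2 ^ e) ^ (2 * k + 1))
    (x y : F) (x₁ y₁ : K)
    (hind : LinearIndependent K ![(x, x₁), (y, y₁)])
    (α : K)
    (h : algebraMap K F (α ^ 2) *
          (algebraMap K F x₁ * y + algebraMap K F y₁ * x) ^ (2 ^ e + 1) +
        algebraMap K F α * (x * y ^ (2 ^ e) + x ^ (2 ^ e) * y) = 0) :
    α = 0 := by
  by_contra hα
  have : Fact (Nat.Prime 2) := ⟨Nat.prime_two⟩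
  have : CharP K 2 := charP_of_card_eq_prime_pow hK
  have : CharP F 2 := charP_of_injective_algebraMap (algebraMap K F).injective 2
  have hq : ∀ a : K, (algebraMap K F a) ^ (2 ^ e) = algebraMap K F a := by
    intro a
    rw [← map_pow, ← hK, FiniteField.pow_card]
  have hinj : ∀ a : K, a ≠ 0 → algebraMap K F a ≠ 0 := by
    intro a ha; simpa using ha
  have h' : algebraMap K F α * (algebraMap K F x₁ * y + algebraMap K F y₁ * x) ^ (2 ^ e + 1)
      + (x * y ^ (2 ^ e) + x ^ (2 ^ e) * y) = 0 := by
    apply mul_left_cancel₀ (hinj α hα)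
    rw [map_pow] at h
    linear_combination h
  have hli := LinearIndependent.pair_iff.1 hind
  have h2K : (2 : K) = 0 := CharTwo.two_eq_zero
  have hz : algebraMap K F x₁ * y + algebraMap K F y₁ * x = 0 := by
    by_cases hx : x₁ = 0
    · by_cases hy : y₁ = 0
      · simp [hx, hy]
      · rw [add_comm]
        apply z_eq_zero e k F hF y x _ _ _ (hq y₁) (hq x₁) (hq α) (hinj α hα) (hinj _ hy)
        rw [add_comm (algebraMap K F y₁ * x)]
        linear_combination h'
    · exact z_eq_zero e k F hF x y _ _ _ (hq x₁) (hq y₁) (hq α) (hinj α hα) (hinj _ hx) h'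
  have h0 := hli y₁ x₁ (by
    ext
    · simp only [Prod.fst_add, Prod.smul_fst, Prod.fst_zero]
      rw [Algebra.smul_def, Algebra.smul_def]
      linear_combination hz
    · simp only [Prod.snd_add, Prod.smul_snd, smul_eq_mul, Prod.snd_zero]
      linear_combination (x₁ * y₁) * h2K)
  obtain ⟨rfl, rfl⟩ := h0
  have hx0 : x ≠ 0 := by
    rintro rfl
    have := hli 1 0 (by simp)
    simp at this
  have h2 : (2 : F) = 0 := CharTwo.two_eq_zero
  have ht : (y / x) ^ Fintype.card K = y / x := by
    rw [hK, div_pow]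
    simp at h'
    field_simp
    linear_combination h' - x ^ (2 ^ e) * y * h2
  have : ∃ t : K, algebraMap K F t = y / x := by
    have hroots := FiniteField.roots_X_pow_card_sub_X K
    have hprod : (Polynomial.X ^ Fintype.card K - Polynomial.X : Polynomial K) =
        ∏ a : K, (Polynomial.X - Polynomial.C a) := by
      have hc := FiniteField.X_pow_card_sub_X_natDegree_eq K (Fintype.one_lt_card (α := K))
      have hm : (Polynomial.X ^ Fintype.card K - Polynomial.X : Polynomial K).Monic := by
        apply Polynomial.monic_X_pow_sub
        rw [Polynomial.degree_X]
        exact_mod_cast Fintype.one_lt_card (α := K)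
      have := Polynomial.prod_multiset_X_sub_C_of_monic_of_roots_card_eq hm
        (by rw [hroots, hc]; rfl)
      rw [hroots] at this
      exact this.symm
    have he := congrArg (Polynomial.aeval (y / x)) hprod
    simp only [map_sub, map_pow, map_prod, Polynomial.aeval_X, Polynomial.aeval_C, ht,
      sub_self] at he
    obtain ⟨t, -, h3⟩ := Finset.prod_eq_zero_iff.1 he.symm
    exact ⟨t, (sub_eq_zero.1 h3).symm⟩
  obtain ⟨t, ht⟩ := this
  have := hli t (-1) (by
    ext
    · simp only [Prod.fst_add, Prod.smul_fst, Prod.fst_zero]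
      rw [Algebra.smul_def, ht]
      field_simp
      simp

    · simp)
  simp at this
end
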